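/- arXiv:1908.10889 — 10 statements merged into one kernel-verified Lean document; each statement's English description precedes it below -/
import Mathlib

section
/- For every real symmetric 3×3 matrix M with trace zero, the square of its spectral norm is at most two thirds of the square of its Frobenius norm: ‖M‖₂² ≤ (2/3)|M|². -/
open scoped Matrix.Norms.L2Operator in
/-- The Euclidean operator norm of a real symmetric matrix is the largest absolute value of its
eigenvalues. -/
lemma Matrix.IsHermitian.norm_toEuclideanCLM {n : Type*} [Fintype n] [DecidableEq n]
    {M : Matrix n n ℝ} (hM : M.IsHermitian) :
    ‖Matrix.toEuclideanCLM (𝕜 := ℝ) M‖ = ‖hM.eigenvalues‖ := by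
  rw [← Matrix.cstar_norm_def]
  conv_lhs => rw [hM.spectral_theorem, Unitary.conjStarAlgAut_apply]
  rw [← Unitary.coe_star, CStarRing.norm_mul_coe_unitary, CStarRing.norm_coe_unitary_mul,
    Matrix.l2_opNorm_diagonal]
  rfl

/-- The squared Frobenius norm of a real symmetric matrix is the sum of the squares of its
eigenvalues. -/
lemma Matrix.IsHermitian.sum_sq_eq_sum_eigenvalues_sq {n : Type*} [Fintype n] [DecidableEq n]
    {M : Matrix n n ℝ} (hM : M.IsHermitian) :
    ∑ i, ∑ j, (M i j) ^ 2 = ∑ i, hM.eigenvalues i ^ 2 := by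
  have h : ∑ i, ∑ j, (M i j) ^ 2 = (M * M).trace := by
    simp only [Matrix.trace, Matrix.diag_apply, Matrix.mul_apply]
    refine Finset.sum_congr rfl fun i _ => Finset.sum_congr rfl fun j _ => ?_
    rw [sq, show M j i = M i j by simpa using hM.apply i j]
  rw [h]
  conv_lhs => rw [hM.spectral_theorem, ← map_mul, Unitary.conjStarAlgAut_apply,
    Matrix.trace_mul_cycle, Unitary.coe_star_mul_self, one_mul, Matrix.diagonal_mul_diagonal,
    Matrix.trace_diagonal]
  simp [sq]

/-- For every real symmetric 3×3 matrix `M` with trace zero, the square of its spectral norm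
(operator norm with respect to the Euclidean norm on `ℝ³`) is at most two thirds of the square
of its Frobenius norm. -/
theorem stmt0 (M : Matrix (Fin 3) (Fin 3) ℝ) (hsym : M.IsSymm) (htr : M.trace = 0) :
    ‖Matrix.toEuclideanCLM (𝕜 := ℝ) M‖ ^ 2 ≤ (2 / 3) * ∑ i, ∑ j, (M i j) ^ 2 := by
  have hM : M.IsHermitian := by
    rwa [Matrix.IsHermitian, Matrix.conjTranspose_eq_transpose_of_trivial]
  have hsum : ∑ i, hM.eigenvalues i = 0 := by
    simpa [htr] using hM.trace_eq_sum_eigenvalues.symm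
  rw [hM.norm_toEuclideanCLM, hM.sum_sq_eq_sum_eigenvalues_sq]
  generalize hM.eigenvalues = v at hsum ⊢
  obtain ⟨i, hi⟩ : ∃ i, ‖v‖ = ‖v i‖ := by
    obtain ⟨i, -, hi⟩ := Finset.exists_mem_eq_sup Finset.univ Finset.univ_nonempty (‖v ·‖₊)
    exact ⟨i, by rw [Pi.norm_def, hi, coe_nnnorm]⟩
  rw [hi, Real.norm_eq_abs, sq_abs]
  simp only [Fin.sum_univ_three] at hsum ⊢
  have h0 : v 0 = -(v 1 + v 2) := by linarith
  fin_cases i <;> simp only [Fin.zero_eta, Fin.mk_one, Fin.reduceFinMk, h0]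
  · nlinarith [sq_nonneg (v 1 - v 2)]
  · nlinarith [sq_nonneg (v 1 + 2 * v 2)]
  · nlinarith [sq_nonneg (2 * v 1 + v 2)]
end

section
/- Let M, N, P be real symmetric 3×3 matrices each with trace zero. Then ∑_{i=1}^{3} (M_{i1} + N_{i2} + P_{i3})² ≤ (5/3)(|M|² + |N|² + |P|²). -/
/-- Cauchy–Schwarz with weights `2/3`, `1/2`, `1/2`. -/
theorem add_add_sq_le_weighted (a b c : ℝ) :
    (a + b + c) ^ 2 ≤ (5 / 3) * (3 / 2 * a ^ 2 + 2 * b ^ 2 + 2 * c ^ 2) := by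
  nlinarith [sq_nonneg (3 * a - 4 * b), sq_nonneg (3 * a - 4 * c), sq_nonneg (b - c)]

/-- If three reals sum to zero, the sum of their squares is at least `3/2` times the square
of any one of them. -/
theorem three_halves_sq_le_of_add_eq_zero {a b c : ℝ} (h : a + b + c = 0) :
    3 / 2 * a ^ 2 ≤ a ^ 2 + b ^ 2 + c ^ 2 := by
  obtain rfl : a = -b - c := by linarith
  nlinarith [sq_nonneg (b - c)]

/-- For real symmetric traceless 3×3 matrices `M`, `N`, `P`,
`∑ᵢ (Mᵢ₁ + Nᵢ₂ + Pᵢ₃)² ≤ (5/3)(|M|² + |N|² + |P|²)` where `|·|` is the Frobenius norm. -/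
theorem stmt2 (M N P : Matrix (Fin 3) (Fin 3) ℝ)
    (hM : M.IsSymm) (hN : N.IsSymm) (hP : P.IsSymm)
    (htM : M.trace = 0) (htN : N.trace = 0) (htP : P.trace = 0) :
    ∑ i, (M i 0 + N i 1 + P i 2) ^ 2 ≤
      (5 / 3) * ((∑ i, ∑ j, (M i j) ^ 2) + (∑ i, ∑ j, (N i j) ^ 2) +
        (∑ i, ∑ j, (P i j) ^ 2)) := by
  simp only [Matrix.trace, Matrix.diag, Fin.sum_univ_three] at *
  rw [hM.apply 0 1, hM.apply 0 2, hM.apply 1 2, hN.apply 0 1, hN.apply 0 2, hN.apply 1 2,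
    hP.apply 0 1, hP.apply 0 2, hP.apply 1 2]
  have dM := three_halves_sq_le_of_add_eq_zero htM
  have dN := three_halves_sq_le_of_add_eq_zero
    (show N 1 1 + N 0 0 + N 2 2 = 0 by linarith)
  have dP := three_halves_sq_le_of_add_eq_zero
    (show P 2 2 + P 0 0 + P 1 1 = 0 by linarith)
  have c₀ := add_add_sq_le_weighted (M 0 0) (N 0 1) (P 0 2)
  have c₁ := add_add_sq_le_weighted (N 1 1) (M 0 1) (P 1 2)
  have c₂ := add_add_sq_le_weighted (P 2 2) (M 0 2) (N 1 2)
  linarith [sq_nonneg (M 1 2), sq_nonneg (N 0 2), sq_nonneg (P 0 1)]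
end

section
/- Let A > −3/5 and set c(A) = (1/2)·min{1, 1 + (5/3)A} and C(A) = (1/2)·max{1, 1 + (5/3)A}. Then c(A) > 0, and for all real symmetric traceless 3×3 matrices M, N, P, writing v_i = M_{i1} + N_{i2} + P_{i3} for i = 1,2,3, one has c(A)(|M|² + |N|² + |P|²) ≤ (1/2)(|M|² + |N|² + |P|²) + (A/2)∑_{i=1}^{3} v_i² ≤ C(A)(|M|² + |N|² + |P|²). (Coercivity and boundedness of the elastic energy density f_e(∇Q) = (1/2)|∇Q|² + (A/2)|div Q|² for Q-tensor fields.) -/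
/-- Cauchy–Schwarz with weights `2/3, 1/2, 1/2`. -/
theorem sq_add_add_le_weighted (a b c : ℝ) :
    (a + b + c) ^ 2 ≤ (5/3) * ((3/2) * a ^ 2 + 2 * b ^ 2 + 2 * c ^ 2) := by
  linarith [sq_nonneg (3 * a / 2 - 2 * b), sq_nonneg (3 * a / 2 - 2 * c), sq_nonneg (2 * b - 2 * c)]

/-- Each diagonal entry of a symmetric traceless `3 × 3` matrix satisfies
`(3/2) d² + 2 (off-diagonal squares) ≤ |Q|²`. -/
theorem diag_add_offDiag_le_frobenius {Q : Matrix (Fin 3) (Fin 3) ℝ} (hQ : Q.IsSymm)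
    (htr : Q.trace = 0) (k : Fin 3) :
    (3/2) * Q k k ^ 2 + 2 * (Q 0 1 ^ 2 + Q 0 2 ^ 2 + Q 1 2 ^ 2) ≤ ∑ i, ∑ j, Q i j ^ 2 := by
  simp only [Matrix.trace_fin_three] at htr
  simp only [Fin.sum_univ_three, hQ.apply 0 1, hQ.apply 0 2, hQ.apply 1 2]
  have h2 : Q 2 2 = -Q 0 0 - Q 1 1 := by linarith
  fin_cases k <;> simp only [Fin.zero_eta, Fin.mk_one, Fin.reduceFinMk, h2]
  · nlinarith [sq_nonneg (Q 0 0 + 2 * Q 1 1)]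
  · nlinarith [sq_nonneg (2 * Q 0 0 + Q 1 1)]
  · nlinarith [sq_nonneg (Q 0 0 - Q 1 1)]

/-- The sharp bound `|div Q|² ≤ (5/3) |∇Q|²` for symmetric traceless gradient triples. -/
theorem sum_div_sq_le {M N P : Matrix (Fin 3) (Fin 3) ℝ}
    (hM : M.IsSymm) (hM0 : M.trace = 0) (hN : N.IsSymm) (hN0 : N.trace = 0)
    (hP : P.IsSymm) (hP0 : P.trace = 0) :
    ∑ i, (M i 0 + N i 1 + P i 2) ^ 2 ≤ (5/3) *
      ((∑ i, ∑ j, (M i j) ^ 2) + (∑ i, ∑ j, (N i j) ^ 2) + (∑ i, ∑ j, (P i j) ^ 2)) := by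
  have hm := diag_add_offDiag_le_frobenius hM hM0 0
  have hn := diag_add_offDiag_le_frobenius hN hN0 1
  have hp := diag_add_offDiag_le_frobenius hP hP0 2
  rw [Fin.sum_univ_three, hM.apply 0 1, hM.apply 0 2, hN.apply 1 2]
  linarith [sq_add_add_le_weighted (M 0 0) (N 0 1) (P 0 2),
    sq_add_add_le_weighted (N 1 1) (M 0 1) (P 1 2),
    sq_add_add_le_weighted (P 2 2) (M 0 2) (N 1 2),
    sq_nonneg (M 1 2), sq_nonneg (N 0 2), sq_nonneg (P 0 1)]

/-- Coercivity and boundedness of the elastic energy density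
`f_e(∇Q) = (1/2)|∇Q|² + (A/2)|div Q|²` for `A > -3/5`, with
`c(A) = (1/2) min{1, 1 + (5/3)A} > 0` and `C(A) = (1/2) max{1, 1 + (5/3)A}`.
Here the gradient triple is `(M,N,P)` (symmetric traceless matrices), and
`v i = M i 0 + N i 1 + P i 2` plays the role of `div Q`. -/
theorem stmt4 (A : ℝ) (hA : A > -3/5) :
    0 < (1/2) * min 1 (1 + (5/3) * A) ∧
    ∀ M N P : Matrix (Fin 3) (Fin 3) ℝ,
      M.IsSymm → M.trace = 0 → N.IsSymm → N.trace = 0 → P.IsSymm → P.trace = 0 →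
      (1/2) * min 1 (1 + (5/3) * A) *
          ((∑ i, ∑ j, (M i j) ^ 2) + (∑ i, ∑ j, (N i j) ^ 2) + (∑ i, ∑ j, (P i j) ^ 2)) ≤
        (1/2) * ((∑ i, ∑ j, (M i j) ^ 2) + (∑ i, ∑ j, (N i j) ^ 2) + (∑ i, ∑ j, (P i j) ^ 2)) +
          (A/2) * ∑ i, (M i 0 + N i 1 + P i 2) ^ 2 ∧
      (1/2) * ((∑ i, ∑ j, (M i j) ^ 2) + (∑ i, ∑ j, (N i j) ^ 2) + (∑ i, ∑ j, (P i j) ^ 2)) +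
          (A/2) * ∑ i, (M i 0 + N i 1 + P i 2) ^ 2 ≤
        (1/2) * max 1 (1 + (5/3) * A) *
          ((∑ i, ∑ j, (M i j) ^ 2) + (∑ i, ∑ j, (N i j) ^ 2) + (∑ i, ∑ j, (P i j) ^ 2)) := by
  refine ⟨mul_pos (by norm_num) (lt_min one_pos (by linarith)), ?_⟩
  intro M N P hM hM0 hN hN0 hP hP0
  have hv := sum_div_sq_le hM hM0 hN hN0 hP hP0
  have hv0 : 0 ≤ ∑ i, (M i 0 + N i 1 + P i 2) ^ 2 := Finset.sum_nonneg fun _ _ => sq_nonneg _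
  generalize ∑ i, (M i 0 + N i 1 + P i 2) ^ 2 = v at *
  generalize (∑ i, ∑ j, (M i j) ^ 2) + (∑ i, ∑ j, (N i j) ^ 2) + (∑ i, ∑ j, (P i j) ^ 2) = S at *
  rcases le_total 0 A with h | h
  · rw [min_eq_left (by linarith), max_eq_right (by linarith)]
    constructor <;> nlinarith [mul_nonneg h hv0, mul_le_mul_of_nonneg_left hv h]
  · rw [min_eq_right (by linarith), max_eq_left (by linarith)]
    constructor <;>
      nlinarith [mul_nonpos_of_nonpos_of_nonneg h hv0, mul_le_mul_of_nonpos_left hv h]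
end

section
/- Let A > −3/5 with A ≠ 0. For ω ∈ [0,1] with ω + (5/3)A ≥ 0, define p(A,ω) = 1 + [ (9/5)(ω + (5/3)A) + √( (81/25)(ω + (5/3)A)² + (18/5)A²(ω + (5/3)A)(1−ω) ) ] / (2A²). Then sup{ p(A,ω) : ω ∈ [0,1], ω + (5/3)A ≥ 0 } equals: 1 + 3/A + 9/(5A²) if A ∈ (−3/5, √(18/5)] (A ≠ 0); 1 + (3+5A)/(2√10·A − 6) if A ∈ (√(18/5), 3/5 + √(18/5)]; and 1 + (3 + √(9+6A))/(2A) if A > 3/5 + √(18/5). -/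
/-- The larger root of `A²t² - (9/5)st - (9/10)s(1-ω)` lies below any positive point where this
polynomial is nonnegative. -/
lemma larger_root_le {A s w T : ℝ} (hA0 : A ≠ 0) (hT : 0 < T) (hs : 0 ≤ s) (hw : w ≤ 1)
    (hF : 0 ≤ A ^ 2 * T ^ 2 - 9/5 * s * T - 9/10 * s * (1 - w)) :
    ((9/5) * s + Real.sqrt ((81/25) * s ^ 2 + (18/5) * A ^ 2 * s * (1 - w))) / (2 * A ^ 2)
      ≤ T := by
  have hA2 : 0 < A ^ 2 := by positivity
  have hsw : 0 ≤ s * (1 - w) := mul_nonneg hs (by linarith)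
  have h1 : 9/5 * s ≤ A ^ 2 * T := by
    refine le_of_mul_le_mul_right ?_ hT
    nlinarith
  have h2 : Real.sqrt ((81/25) * s ^ 2 + (18/5) * A ^ 2 * s * (1 - w))
      ≤ 2 * A ^ 2 * T - 9/5 * s := by
    apply Real.sqrt_le_iff.mpr
    constructor
    · nlinarith
    · nlinarith [mul_nonneg hA2.le hF]
  rw [div_le_iff₀ (by positivity)]
  linarith

/-- A positive root of `A²t² - (9/5)st - (9/10)s(1-ω)` is the larger one. -/
lemma larger_root_eq {A s w T : ℝ} (hA0 : A ≠ 0) (hT : 0 < T) (hs : 0 ≤ s) (hw : w ≤ 1)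
    (hF : A ^ 2 * T ^ 2 - 9/5 * s * T - 9/10 * s * (1 - w) = 0) :
    ((9/5) * s + Real.sqrt ((81/25) * s ^ 2 + (18/5) * A ^ 2 * s * (1 - w))) / (2 * A ^ 2)
      = T := by
  refine le_antisymm (larger_root_le hA0 hT hs hw hF.ge) ?_
  rw [le_div_iff₀ (by positivity)]
  have h2 : 2 * A ^ 2 * T - 9/5 * s
      ≤ Real.sqrt ((81/25) * s ^ 2 + (18/5) * A ^ 2 * s * (1 - w)) := by
    apply Real.le_sqrt_of_sq_le
    linear_combination 4 * A ^ 2 * hF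
  linarith

lemma sSup_exponent_eq {A T w₀ : ℝ} (hA0 : A ≠ 0) (hT : 0 < T) (h0 : 0 ≤ w₀) (h1 : w₀ ≤ 1)
    (hs : 0 ≤ w₀ + (5/3) * A)
    (hF0 : A ^ 2 * T ^ 2 - 9/5 * (w₀ + (5/3) * A) * T
      - 9/10 * (w₀ + (5/3) * A) * (1 - w₀) = 0)
    (hF : ∀ w : ℝ, 0 ≤ w → w ≤ 1 → 0 ≤ w + (5/3) * A →
      0 ≤ A ^ 2 * T ^ 2 - 9/5 * (w + (5/3) * A) * T - 9/10 * (w + (5/3) * A) * (1 - w)) :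
    sSup {p : ℝ | ∃ ω : ℝ, ω ∈ Set.Icc (0:ℝ) 1 ∧ 0 ≤ ω + (5/3) * A ∧
        p = 1 + ((9/5) * (ω + (5/3) * A) +
          Real.sqrt ((81/25) * (ω + (5/3) * A) ^ 2 +
            (18/5) * A ^ 2 * (ω + (5/3) * A) * (1 - ω))) / (2 * A ^ 2)} = 1 + T := by
  apply IsGreatest.csSup_eq
  constructor
  · exact ⟨w₀, ⟨h0, h1⟩, hs, by rw [larger_root_eq hA0 hT hs h1 hF0]⟩
  · rintro p ⟨w, ⟨hw0, hw1⟩, hws, rfl⟩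
    linarith [larger_root_le hA0 hT hws hw1 (hF w hw0 hw1 hws)]


/-- For `A > -3/5`, `A ≠ 0`, the supremum over admissible `ω` of
`p(A,ω) = 1 + [(9/5)(ω + (5/3)A) + √((81/25)(ω + (5/3)A)² + (18/5)A²(ω + (5/3)A)(1-ω))]/(2A²)`
is given by the explicit piecewise formula for `p(A)`. -/
theorem stmt5 (A : ℝ) (hA : A > -3/5) (hA0 : A ≠ 0) :
    sSup {p : ℝ | ∃ ω : ℝ, ω ∈ Set.Icc (0:ℝ) 1 ∧ 0 ≤ ω + (5/3) * A ∧
        p = 1 + ((9/5) * (ω + (5/3) * A) +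
          Real.sqrt ((81/25) * (ω + (5/3) * A) ^ 2 +
            (18/5) * A ^ 2 * (ω + (5/3) * A) * (1 - ω))) / (2 * A ^ 2)} =
      (if A ≤ Real.sqrt (18/5) then 1 + 3 / A + 9 / (5 * A ^ 2)
       else if A ≤ 3/5 + Real.sqrt (18/5) then 1 + (3 + 5 * A) / (2 * Real.sqrt 10 * A - 6)
       else 1 + (3 + Real.sqrt (9 + 6 * A)) / (2 * A)) := by
  have hr0 : 0 < Real.sqrt (18/5) := Real.sqrt_pos.mpr (by norm_num)
  have hr2 : Real.sqrt (18/5) ^ 2 = 18/5 := Real.sq_sqrt (by norm_num)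
  have hq : Real.sqrt 10 = 5/3 * Real.sqrt (18/5) := by
    rw [Real.sqrt_eq_iff_mul_self_eq (by norm_num) (by positivity)]
    linear_combination (-25/9) * hr2
  rw [hq]
  set r := Real.sqrt (18/5)
  have hr1 : 3/5 < r := by nlinarith
  split_ifs with hc1 hc2
  · have hA2 : 0 < A ^ 2 := by positivity
    have hAr : A ^ 2 ≤ 18/5 := by nlinarith
    obtain ⟨T, hTdef⟩ : ∃ T, T = 3 / A + 9 / (5 * A ^ 2) := ⟨_, rfl⟩
    have hT : A ^ 2 * T = 9/5 * (1 + 5/3 * A) := by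
      rw [hTdef]; field_simp; ring
    have hTpos : 0 < T := by
      refine pos_of_mul_pos_right (a := A ^ 2) ?_ hA2.le
      rw [hT]; linarith
    have h2T : 1 + 5/3 * A ≤ 2 * T := by
      refine le_of_mul_le_mul_left ?_ hA2
      nlinarith
    rw [add_assoc, ← hTdef]
    refine sSup_exponent_eq (w₀ := 1) hA0 hTpos (by norm_num) le_rfl (by linarith) ?_ ?_
    · linear_combination T * hT
    · intro w _ hw1 _
      have := mul_nonneg (sub_nonneg.mpr hw1)
        (by linarith : 0 ≤ 2 * T - (w + 5/3 * A))
      linear_combination 9/10 * this - T * hT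
  · push Not at hc1
    obtain ⟨T, hTdef⟩ : ∃ T, T = (3 + 5 * A) / (2 * (5/3 * r) * A - 6) := ⟨_, rfl⟩
    have hd : 0 < 2 * (5/3 * r) * A - 6 := by nlinarith
    have hT : T * (2 * (5/3 * r) * A - 6) = 3 + 5 * A := by
      rw [hTdef, div_mul_cancel₀ _ hd.ne']
    have hTpos : 0 < T := by rw [hTdef]; exact div_pos (by linarith) hd
    have hlin : A * T = r / 2 * (T + (1 + 5/3 * A) / 2) := by
      linear_combination r / 12 * hT - (5/18 * A * T) * hr2
    have hsq : A ^ 2 * T ^ 2 = 9/10 * (T + (1 + 5/3 * A) / 2) ^ 2 := by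
      linear_combination (A * T + r / 2 * (T + (1 + 5/3 * A) / 2)) * hlin
        + (T + (1 + 5/3 * A) / 2) ^ 2 / 4 * hr2
    rw [← hTdef]
    refine sSup_exponent_eq (w₀ := T + (1 - 5/3 * A) / 2) hA0 hTpos ?_ ?_ ?_ ?_ ?_
    · have : (5/3 * A - 1) / 2 ≤ T := by
        rw [hTdef, le_div_iff₀ hd]
        nlinarith [mul_nonneg (sub_nonneg.mpr hc2) (by nlinarith : 0 ≤ A * r)]
      linarith
    · have : T ≤ (1 + 5/3 * A) / 2 := by
        rw [hTdef, div_le_iff₀ hd]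
        nlinarith [mul_nonneg (sub_nonneg.mpr hc1.le) (by nlinarith : 0 ≤ (1 + 5/3 * A) * r)]
      linarith
    · linarith
    · linear_combination hsq
    · intro w _ _ _
      linear_combination 9/10 * sq_nonneg (w - (T + (1 - 5/3 * A) / 2)) - hsq
  · push Not at hc1 hc2
    have hApos : 0 < A := by linarith
    have hq0 := Real.sqrt_nonneg (9 + 6 * A)
    have hq2 : Real.sqrt (9 + 6 * A) ^ 2 = 9 + 6 * A := Real.sq_sqrt (by linarith)
    have hqle : Real.sqrt (9 + 6 * A) ≤ A * (5/3 * A - 1) - 3 := by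
      have hu : 0 ≤ (A - 3/5) ^ 2 - 18/5 := by nlinarith
      apply Real.sqrt_le_iff.mpr
      constructor
      · nlinarith
      · have : 0 ≤ A * (((A - 3/5) ^ 2 - 18/5) * (25/9 * (A - 3/5) + 5/3)) :=
          mul_nonneg hApos.le (mul_nonneg hu (by linarith))
        linear_combination this
    set q := Real.sqrt (9 + 6 * A)
    obtain ⟨T, hTdef⟩ : ∃ T, T = (3 + q) / (2 * A) := ⟨_, rfl⟩
    have hT : 2 * A * T = 3 + q := by rw [hTdef]; field_simp
    have hTpos : 0 < T := by rw [hTdef]; positivity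
    have hTle : 2 * T ≤ 5/3 * A - 1 := by
      refine le_of_mul_le_mul_left ?_ hApos
      linarith
    have hroot : A ^ 2 * T ^ 2 - 3 * A * T - 3/2 * A = 0 := by
      linear_combination (2 * A * T - 3 + q) / 4 * hT + hq2 / 4
    rw [← hTdef]
    refine sSup_exponent_eq (w₀ := 0) hA0 hTpos le_rfl (by norm_num) (by linarith) ?_ ?_
    · linear_combination hroot
    · intro w hw0 _ _
      have := mul_nonneg hw0 (by linarith : 0 ≤ w + (5/3 * A - 1 - 2 * T))
      linear_combination 9/10 * this - hroot
end

section
/- The function p(A) defined for A > 0 by the piecewise formula p(A) = 1 + 3/A + 9/(5A²) for A ∈ (0, √(18/5)], p(A) = 1 + (3+5A)/(2√10·A − 6) for A ∈ (√(18/5), 3/5 + √(18/5)], and p(A) = 1 + (3 + √(9+6A))/(2A) for A > 3/5 + √(18/5), is decreasing (antitone) on (0, ∞). -/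
/-- The borderline integrability exponent `p(A)` in the interior `W^{1,q}` estimate. -/
noncomputable def pA (A : ℝ) : ℝ :=
  if A ≤ Real.sqrt (18/5) then 1 + 3 / A + 9 / (5 * A ^ 2)
  else if A ≤ 3/5 + Real.sqrt (18/5) then 1 + (3 + 5 * A) / (2 * Real.sqrt 10 * A - 6)
  else 1 + (3 + Real.sqrt (9 + 6 * A)) / (2 * A)

theorem antitoneOn_one_add_div_add_div_sq :
    AntitoneOn (fun A : ℝ => 1 + 3 / A + 9 / (5 * A ^ 2)) (Set.Ioi 0) := by
  intro a ha b _ hab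
  have ha : 0 < a := ha
  dsimp only
  gcongr

theorem antitoneOn_one_add_div_sub :
    AntitoneOn (fun A : ℝ => 1 + (3 + 5 * A) / (2 * √10 * A - 6)) {A | 3 < √10 * A} := by
  intro a ha b hb hab
  simp only [Set.mem_ofPred_eq] at ha hb
  have h : √10 * a ≤ √10 * b := by gcongr
  dsimp only
  gcongr 1 + ?_
  rw [div_le_div_iff₀ (by linarith) (by linarith)]
  nlinarith

theorem antitoneOn_one_add_sqrt_div :
    AntitoneOn (fun A : ℝ => 1 + (3 + √(9 + 6 * A)) / (2 * A)) (Set.Ioi 0) := by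
  intro a ha b hb hab
  have ha : 0 < a := ha
  have hb : 0 < b := hb
  have key : √(9 + 6 * b) * a ≤ √(9 + 6 * a) * b := by
    rw [← pow_le_pow_iff_left₀ (by positivity) (by positivity) two_ne_zero]
    rw [mul_pow, mul_pow, Real.sq_sqrt (by positivity), Real.sq_sqrt (by positivity)]
    nlinarith [mul_nonneg (mul_pos ha hb).le (sub_nonneg.2 hab), pow_le_pow_left₀ ha.le hab 2]
  dsimp only
  gcongr 1 + ?_
  rw [div_le_div_iff₀ (by positivity) (by positivity)]
  linarith

theorem sqrt_eighteen_div_five : √(18 / 5 : ℝ) = 3 / 5 * √10 := by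
  have h : √(10 : ℝ) ^ 2 = 10 := Real.sq_sqrt (by norm_num)
  rw [Real.sqrt_eq_iff_mul_self_eq (by norm_num) (by positivity)]
  linarith

theorem three_lt_sqrt_ten : 3 < √(10 : ℝ) := by
  rw [Real.lt_sqrt (by norm_num)]
  norm_num

theorem pA_eq_first {A : ℝ} (h : A ≤ √(18 / 5)) : pA A = 1 + 3 / A + 9 / (5 * A ^ 2) :=
  if_pos h

theorem pA_eq_second {A : ℝ} (h₁ : √(18 / 5) ≤ A) (h₂ : A ≤ 3 / 5 + √(18 / 5)) :
    pA A = 1 + (3 + 5 * A) / (2 * √10 * A - 6) := by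
  rcases h₁.eq_or_lt with rfl | h
  · have h : √(10 : ℝ) ^ 2 = 10 := Real.sq_sqrt (by norm_num)
    have hden : 2 * √10 * (3 / 5 * √10) - 6 = 6 := by linarith
    rw [pA_eq_first le_rfl, sqrt_eighteen_div_five, hden]
    field_simp
    rw [h]
    linarith
  · rw [pA, if_neg h.not_ge, if_pos h₂]

theorem pA_eq_third {A : ℝ} (h : 3 / 5 + √(18 / 5) ≤ A) :
    pA A = 1 + (3 + √(9 + 6 * A)) / (2 * A) := by
  rcases h.eq_or_lt with rfl | h
  · have h : √(10 : ℝ) ^ 2 = 10 := Real.sq_sqrt (by norm_num)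
    have hsqrt : √(9 + 6 * (3 / 5 + 3 / 5 * √10)) = 3 + 3 / 5 * √10 := by
      rw [Real.sqrt_eq_iff_mul_self_eq (by positivity) (by positivity)]
      linarith
    rw [pA_eq_second (by linarith) le_rfl, sqrt_eighteen_div_five, hsqrt]
    congr 1
    have hpos := three_lt_sqrt_ten
    rw [div_eq_div_iff (by nlinarith) (by positivity)]
    nlinarith
  · have h' : √(18 / 5) < A := by linarith
    rw [pA, if_neg h'.not_ge, if_neg h.not_ge]

/-- `p(A)` is decreasing (antitone) on `(0, ∞)`. -/
theorem stmt6 : AntitoneOn pA (Set.Ioi (0 : ℝ)) := by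
  have hs : 0 < √(18 / 5 : ℝ) := by positivity
  have hfirst : AntitoneOn pA (Set.Ioc 0 √(18 / 5)) :=
    (antitoneOn_one_add_div_add_div_sq.mono fun _ hA => hA.1).congr
      fun _ hA => (pA_eq_first hA.2).symm
  have hsecond : AntitoneOn pA (Set.Icc √(18 / 5) (3 / 5 + √(18 / 5))) := by
    refine (antitoneOn_one_add_div_sub.mono fun A hA => ?_).congr
      fun _ hA => (pA_eq_second hA.1 hA.2).symm
    have h₁ := hA.1
    rw [sqrt_eighteen_div_five] at h₁
    have h := three_lt_sqrt_ten
    simp only [Set.mem_ofPred_eq]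
    nlinarith
  have hthird : AntitoneOn pA (Set.Ici (3 / 5 + √(18 / 5))) :=
    (antitoneOn_one_add_sqrt_div.mono fun _ hA =>
      lt_of_lt_of_le (by positivity) (Set.mem_Ici.1 hA)).congr
      fun _ hA => (pA_eq_third hA).symm
  have hle : √(18 / 5 : ℝ) ≤ 3 / 5 + √(18 / 5) := by linarith
  have htail := hsecond.union_right hthird (isGreatest_Icc hle) isLeast_Ici
  rw [Set.Icc_union_Ici_eq_Ici hle] at htail
  have hall := hfirst.union_right htail (isGreatest_Ioc hs) isLeast_Ici
  rwa [Set.Ioc_union_Ici_eq_Ioi hs] at hall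
end

section
/- Let Q ∈ 𝒬_phy have eigenvalues λ₁ ≤ λ₂ ≤ λ₃ with corresponding orthonormal eigenvectors n, m, p, so Q = λ₁ n⊗n + λ₂ m⊗m + λ₃ p⊗p. Then the distance from Q to the complement of 𝒬_phy (in Frobenius norm, within 𝒬) equals (√6/2)(λ₁ + 1/3), and this distance is attained at the matrix Q' = −(1/3) n⊗n + (λ₂ + (λ₁ + 1/3)/2) m⊗m + (λ₃ + (λ₁ + 1/3)/2) p⊗p, i.e., d(Q) = |Q − Q'| = (√6/2)(λ₁ + 1/3). -/
open Matrix

/-- `𝒬`: the set of real symmetric traceless 3×3 matrices. -/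
def QSpace : Set (Matrix (Fin 3) (Fin 3) ℝ) := {Q | Q.IsSymm ∧ Q.trace = 0}

/-- `𝒬_phy`: physical Q-tensors, i.e. symmetric traceless matrices whose eigenvalues all lie
in `[-1/3, 2/3]`. -/
def QPhy : Set (Matrix (Fin 3) (Fin 3) ℝ) :=
  {Q | Q ∈ QSpace ∧ spectrum ℝ Q ⊆ Set.Icc (-(1:ℝ)/3) (2/3)}

/-- The Frobenius distance between two matrices. -/
noncomputable def frobDist (X Y : Matrix (Fin 3) (Fin 3) ℝ) : ℝ :=
  Real.sqrt (∑ i, ∑ j, (X i j - Y i j) ^ 2)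

/-- `d(Q)`: the distance, in Frobenius norm, from `Q` to the complement of `𝒬_phy` within `𝒬`. -/
noncomputable def dQ (Q : Matrix (Fin 3) (Fin 3) ℝ) : ℝ :=
  sInf ((fun Q' => frobDist Q Q') '' (QSpace \ QPhy))

/-- A real number is in the spectrum of a matrix iff it has a nonzero eigenvector. -/
lemma mem_spectrum_iff_exists_mulVec_eq_smul (A : Matrix (Fin 3) (Fin 3) ℝ) (μ : ℝ) :
    μ ∈ spectrum ℝ A ↔ ∃ v : Fin 3 → ℝ, v ≠ 0 ∧ A *ᵥ v = μ • v := by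
  rw [spectrum.mem_iff, Matrix.isUnit_iff_isUnit_det, isUnit_iff_ne_zero, not_not,
    ← Matrix.exists_mulVec_eq_zero_iff]
  refine exists_congr fun v => and_congr_right fun _ => ?_
  rw [Matrix.sub_mulVec, sub_eq_zero, Matrix.algebraMap_eq_diagonal, eq_comm]
  have : diagonal (algebraMap ℝ (Fin 3 → ℝ) μ) *ᵥ v = μ • v := by
    ext i
    simp [Matrix.mulVec_diagonal]
  rw [this]

/-- Cauchy–Schwarz for a traceless matrix against the traceless part of `v ⊗ v`. -/
lemma three_halves_mul_sq_dotProduct_mulVec_le (D : Matrix (Fin 3) (Fin 3) ℝ) (hD : D.trace = 0)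
    (v : Fin 3 → ℝ) :
    3 / 2 * (v ⬝ᵥ D *ᵥ v) ^ 2 ≤ (v ⬝ᵥ v) ^ 2 * ∑ i, ∑ j, D i j ^ 2 := by
  have h := Finset.sum_mul_sq_le_sq_mul_sq (Finset.univ : Finset (Fin 3 × Fin 3))
    (fun x => D x.1 x.2)
    (fun x => (vecMulVec v v - (v ⬝ᵥ v / 3) • (1 : Matrix (Fin 3) (Fin 3) ℝ)) x.1 x.2)
  simp only [Fintype.sum_prod_type] at h
  have h1 : ∑ i, ∑ j, D i j *
      (vecMulVec v v - (v ⬝ᵥ v / 3) • (1 : Matrix (Fin 3) (Fin 3) ℝ)) i j = v ⬝ᵥ D *ᵥ v := by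
    simp [Matrix.trace, Fin.sum_univ_three] at hD
    simp [Fin.sum_univ_three, Matrix.mulVec, dotProduct, vecMulVec_apply]
    linear_combination (-(v 0 * v 0 + v 1 * v 1 + v 2 * v 2) / 3) * hD
  have h2 : ∑ i, ∑ j,
      ((vecMulVec v v - (v ⬝ᵥ v / 3) • (1 : Matrix (Fin 3) (Fin 3) ℝ)) i j) ^ 2 =
        2 / 3 * (v ⬝ᵥ v) ^ 2 := by
    simp [Fin.sum_univ_three, dotProduct, vecMulVec_apply]
    ring
  rw [h1, h2] at h
  linarith

lemma trace_spectral_of_unit {n m p : Fin 3 → ℝ} (hnn : n ⬝ᵥ n = 1) (hmm : m ⬝ᵥ m = 1)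
    (hpp : p ⬝ᵥ p = 1) (a b c : ℝ) :
    (a • vecMulVec n n + b • vecMulVec m m + c • vecMulVec p p).trace = a + b + c := by
  simp [Matrix.trace_vecMulVec, hnn, hmm, hpp]

lemma mem_spectrum_spectral_of_orthogonal {n m p : Fin 3 → ℝ} (hnn : n ⬝ᵥ n = 1)
    (hnm : n ⬝ᵥ m = 0) (hnp : n ⬝ᵥ p = 0) (a b c : ℝ) :
    a ∈ spectrum ℝ (a • vecMulVec n n + b • vecMulVec m m + c • vecMulVec p p) := by
  rw [mem_spectrum_iff_exists_mulVec_eq_smul]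
  refine ⟨n, fun h => by simp [h] at hnn, ?_⟩
  simp [Matrix.add_mulVec, Matrix.smul_mulVec, Matrix.vecMulVec_mulVec, hnn,
    dotProduct_comm m n, dotProduct_comm p n, hnm, hnp]

lemma sum_sq_dotProduct_of_orthonormal {n m p : Fin 3 → ℝ}
    (hnn : n ⬝ᵥ n = 1) (hmm : m ⬝ᵥ m = 1) (hpp : p ⬝ᵥ p = 1)
    (hnm : n ⬝ᵥ m = 0) (hnp : n ⬝ᵥ p = 0) (hmp : m ⬝ᵥ p = 0) (v : Fin 3 → ℝ) :
    (n ⬝ᵥ v) ^ 2 + (m ⬝ᵥ v) ^ 2 + (p ⬝ᵥ v) ^ 2 = v ⬝ᵥ v := by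
  have h : (Matrix.of ![n, m, p]) * (Matrix.of ![n, m, p])ᵀ = 1 := by
    simp only [dotProduct, Fin.sum_univ_three] at *
    ext i j
    fin_cases i <;> fin_cases j <;> simp [Matrix.mul_apply, Fin.sum_univ_three] <;> linarith
  have h' := mul_eq_one_comm.mp h
  have h3 : v ⬝ᵥ ((Matrix.of ![n, m, p])ᵀ * Matrix.of ![n, m, p]) *ᵥ v = v ⬝ᵥ v := by
    rw [h', Matrix.one_mulVec]
  rw [← h3]
  simp [Fin.sum_univ_three, Matrix.mulVec, dotProduct, Matrix.mul_apply]
  ring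

lemma sum_sq_spectral_of_orthonormal {n m p : Fin 3 → ℝ}
    (hnn : n ⬝ᵥ n = 1) (hmm : m ⬝ᵥ m = 1) (hpp : p ⬝ᵥ p = 1)
    (hnm : n ⬝ᵥ m = 0) (hnp : n ⬝ᵥ p = 0) (hmp : m ⬝ᵥ p = 0) (a b c : ℝ) :
    ∑ i, ∑ j, (a • vecMulVec n n + b • vecMulVec m m + c • vecMulVec p p) i j ^ 2 =
      a ^ 2 + b ^ 2 + c ^ 2 := by
  have h : ∑ i, ∑ j, (a • vecMulVec n n + b • vecMulVec m m + c • vecMulVec p p) i j ^ 2 =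
      a ^ 2 * (n ⬝ᵥ n) ^ 2 + b ^ 2 * (m ⬝ᵥ m) ^ 2 + c ^ 2 * (p ⬝ᵥ p) ^ 2 +
      2 * a * b * (n ⬝ᵥ m) ^ 2 + 2 * a * c * (n ⬝ᵥ p) ^ 2 + 2 * b * c * (m ⬝ᵥ p) ^ 2 := by
    simp [Fin.sum_univ_three, dotProduct, vecMulVec_apply]
    ring
  rw [h, hnn, hmm, hpp, hnm, hnp, hmp]
  ring

lemma frobDist_spectral_of_orthonormal {n m p : Fin 3 → ℝ}
    (hnn : n ⬝ᵥ n = 1) (hmm : m ⬝ᵥ m = 1) (hpp : p ⬝ᵥ p = 1)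
    (hnm : n ⬝ᵥ m = 0) (hnp : n ⬝ᵥ p = 0) (hmp : m ⬝ᵥ p = 0) (a b c t : ℝ) (ht : 0 ≤ t) :
    frobDist (a • vecMulVec n n + b • vecMulVec m m + c • vecMulVec p p)
      ((a - t) • vecMulVec n n + (b + t / 2) • vecMulVec m m + (c + t / 2) • vecMulVec p p) =
      √6 / 2 * t := by
  have h := sum_sq_spectral_of_orthonormal hnn hmm hpp hnm hnp hmp t (-(t / 2)) (-(t / 2))
  unfold frobDist
  rw [Real.sqrt_eq_iff_mul_self_eq (by positivity) (by positivity)]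
  have h6 : √6 * √6 = 6 := Real.mul_self_sqrt (by norm_num)
  trans ∑ i, ∑ j,
      (t • vecMulVec n n + -(t / 2) • vecMulVec m m + -(t / 2) • vecMulVec p p) i j ^ 2
  · refine Finset.sum_congr rfl fun i _ => Finset.sum_congr rfl fun j _ => ?_
    simp only [Matrix.add_apply, Matrix.smul_apply, smul_eq_mul]
    ring
  · rw [h]
    linear_combination -(t ^ 2) / 4 * h6

lemma isSymm_spectral (n m p : Fin 3 → ℝ) (a b c : ℝ) :
    (a • vecMulVec n n + b • vecMulVec m m + c • vecMulVec p p).IsSymm := by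
  simp [Matrix.IsSymm, Matrix.transpose_vecMulVec]

/-- If a matrix `R` of zero trace has an eigenvalue outside `[-1/3, 2/3]`, it is at distance at
least `√6 / 2 * (l + 1/3)` from each traceless `Q` with quadratic form between `l` and `-2 * l`. -/
lemma le_frobDist_of_notMem_Icc {l μ : ℝ} (hl : -(1 : ℝ) / 3 ≤ l)
    {Q R : Matrix (Fin 3) (Fin 3) ℝ} (hQ : Q.trace = 0) (hR : R.trace = 0)
    (hlow : ∀ v, l * (v ⬝ᵥ v) ≤ v ⬝ᵥ Q *ᵥ v) (hup : ∀ v, v ⬝ᵥ Q *ᵥ v ≤ -2 * l * (v ⬝ᵥ v))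
    (hμ : μ ∈ spectrum ℝ R) (hμ' : μ ∉ Set.Icc (-(1 : ℝ) / 3) (2 / 3)) :
    √6 / 2 * (l + 1 / 3) ≤ frobDist Q R := by
  obtain ⟨v, hv, hRv⟩ := (mem_spectrum_iff_exists_mulVec_eq_smul R μ).mp hμ
  have hs : 0 < v ⬝ᵥ v := lt_of_le_of_ne
    (Finset.sum_nonneg fun i _ => mul_self_nonneg (v i))
    (fun h => hv (dotProduct_self_eq_zero.mp h.symm))
  have hCS := three_halves_mul_sq_dotProduct_mulVec_le (Q - R)
    (by rw [Matrix.trace_sub, hQ, hR, sub_zero]) v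
  have hval : v ⬝ᵥ (Q - R) *ᵥ v = v ⬝ᵥ Q *ᵥ v - μ * (v ⬝ᵥ v) := by
    rw [Matrix.sub_mulVec, dotProduct_sub, hRv, dotProduct_smul, smul_eq_mul]
  have hlv := hlow v
  have huv := hup v
  have habs : (l + 1 / 3) * (v ⬝ᵥ v) ≤ |v ⬝ᵥ (Q - R) *ᵥ v| := by
    rw [hval]
    rw [Set.mem_Icc, not_and_or, not_le, not_le] at hμ'
    rcases hμ' with h | h
    · exact le_trans (by nlinarith) (le_abs_self _)
    · exact le_trans (by nlinarith) (neg_le_abs _)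
  have hsq : ((l + 1 / 3) * (v ⬝ᵥ v)) ^ 2 ≤ (v ⬝ᵥ (Q - R) *ᵥ v) ^ 2 := by
    rw [← sq_abs (v ⬝ᵥ (Q - R) *ᵥ v)]
    exact pow_le_pow_left₀ (mul_nonneg (by linarith) hs.le) habs 2
  apply Real.le_sqrt_of_sq_le
  refine le_of_mul_le_mul_left ?_ (pow_pos hs 2)
  refine le_trans (le_of_eq ?_) ((mul_le_mul_of_nonneg_left hsq (by norm_num)).trans hCS)
  have h6 : √6 ^ 2 = 6 := Real.sq_sqrt (by norm_num)
  rw [mul_pow, div_pow, h6]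
  ring

/-- If `Q ∈ 𝒬_phy` has eigenvalues `λ₁ ≤ λ₂ ≤ λ₃` with orthonormal eigenvectors `n, m, p`,
then `d(Q) = (√6/2)(λ₁ + 1/3)`, and this distance is attained at
`Q' = -(1/3) n⊗n + (λ₂ + (λ₁+1/3)/2) m⊗m + (λ₃ + (λ₁+1/3)/2) p⊗p`. -/
theorem stmt8 (lam1 lam2 lam3 : ℝ) (n m p : Fin 3 → ℝ)
    (h12 : lam1 ≤ lam2) (h23 : lam2 ≤ lam3)
    (hnn : n ⬝ᵥ n = 1) (hmm : m ⬝ᵥ m = 1) (hpp : p ⬝ᵥ p = 1)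
    (hnm : n ⬝ᵥ m = 0) (hnp : n ⬝ᵥ p = 0) (hmp : m ⬝ᵥ p = 0)
    (Q : Matrix (Fin 3) (Fin 3) ℝ)
    (hQ : Q = lam1 • vecMulVec n n + lam2 • vecMulVec m m + lam3 • vecMulVec p p)
    (hphy : Q ∈ QPhy) :
    dQ Q = Real.sqrt 6 / 2 * (lam1 + 1/3) ∧
    dQ Q = frobDist Q ((-(1:ℝ)/3) • vecMulVec n n +
      (lam2 + (lam1 + 1/3)/2) • vecMulVec m m +
      (lam3 + (lam1 + 1/3)/2) • vecMulVec p p) := by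
  obtain ⟨⟨-, htr⟩, hspec⟩ := hphy
  have hsum : lam1 + lam2 + lam3 = 0 := by
    rw [← htr, hQ, trace_spectral_of_unit hnn hmm hpp]
  have hl : -(1 : ℝ) / 3 ≤ lam1 := (hspec (by
    rw [hQ]; exact mem_spectrum_spectral_of_orthogonal hnn hnm hnp _ _ _)).1
  have hform (v : Fin 3 → ℝ) : v ⬝ᵥ Q *ᵥ v =
      lam1 * (n ⬝ᵥ v) ^ 2 + lam2 * (m ⬝ᵥ v) ^ 2 + lam3 * (p ⬝ᵥ v) ^ 2 := by
    rw [hQ]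
    simp [Matrix.add_mulVec, Matrix.smul_mulVec, Matrix.vecMulVec_mulVec, dotProduct_comm v]
    ring
  have hid := sum_sq_dotProduct_of_orthonormal hnn hmm hpp hnm hnp hmp
  have hlow (v : Fin 3 → ℝ) : lam1 * (v ⬝ᵥ v) ≤ v ⬝ᵥ Q *ᵥ v := by
    rw [hform, ← hid v]
    nlinarith [sq_nonneg (m ⬝ᵥ v), sq_nonneg (p ⬝ᵥ v)]
  have hup (v : Fin 3 → ℝ) : v ⬝ᵥ Q *ᵥ v ≤ -2 * lam1 * (v ⬝ᵥ v) := by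
    have h3 : lam3 ≤ -2 * lam1 := by linarith
    rw [hform, ← hid v, mul_add, mul_add]
    gcongr <;> linarith
  have hdist (ε : ℝ) (hε : 0 ≤ ε) := frobDist_spectral_of_orthonormal hnn hmm hpp hnm hnp hmp
    lam1 lam2 lam3 (lam1 + 1 / 3 + ε) (by linarith)
  have hmem (ε : ℝ) (hε : 0 < ε) : √6 / 2 * (lam1 + 1 / 3 + ε) ∈
      (fun Q' => frobDist Q Q') '' (QSpace \ QPhy) := by
    refine ⟨_, ⟨⟨isSymm_spectral n m p _ _ _, ?_⟩, fun h => ?_⟩, by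
      simp only [hQ]; exact hdist ε hε.le⟩
    · rw [trace_spectral_of_unit hnn hmm hpp]
      linarith
    · have := (h.2 (mem_spectrum_spectral_of_orthogonal hnn hnm hnp _ _ _)).1
      linarith
  have hlb : √6 / 2 * (lam1 + 1 / 3) ∈
      lowerBounds ((fun Q' => frobDist Q Q') '' (QSpace \ QPhy)) := by
    rintro _ ⟨R, ⟨hR, hRphy⟩, rfl⟩
    obtain ⟨μ, hμ, hμ'⟩ := Set.not_subset.mp fun h => hRphy ⟨hR, h⟩
    exact le_frobDist_of_notMem_Icc hl htr hR.2 hlow hup hμ hμ'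
  have hd : dQ Q = √6 / 2 * (lam1 + 1 / 3) := by
    refine le_antisymm (le_of_forall_pos_le_add fun ε hε => ?_)
      (le_csInf ⟨_, hmem 1 one_pos⟩ hlb)
    have h6 : 0 < √6 / 2 := by positivity
    refine (csInf_le ⟨_, hlb⟩ (hmem (ε / (√6 / 2)) (by positivity))).trans (le_of_eq ?_)
    rw [mul_add _ _ (ε / _), mul_div_cancel₀ _ h6.ne']
  refine ⟨hd, ?_⟩
  have h0 := hdist 0 le_rfl
  rw [add_zero, show lam1 - (lam1 + 1 / 3) = -(1 : ℝ) / 3 by ring] at h0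
  rw [hd, hQ, h0]
end

section
/- Let s, r, s', r' be real numbers with s ≤ r ≤ 0 and s' ≤ r' ≤ 0, and let (a,b,c) and (u,v,w) be two orthonormal vectors in ℝ³ (each of unit Euclidean norm and mutually orthogonal). Then s·s'·a² + r·s'·b² + s·r'·u² + r·r'·v² ≤ s·s' + r·r'. -/
/-- Key scalar inequality: for `s ≤ r ≤ 0`, `s' ≤ r' ≤ 0` and orthonormal vectors
`(a,b,c)`, `(u,v,w)` in `ℝ³`, one has `ss'a² + rs'b² + sr'u² + rr'v² ≤ ss' + rr'`. -/
theorem stmt9 (s r s' r' a b c u v w : ℝ)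
    (hsr : s ≤ r) (hr : r ≤ 0) (hsr' : s' ≤ r') (hr' : r' ≤ 0)
    (hn1 : a ^ 2 + b ^ 2 + c ^ 2 = 1) (hn2 : u ^ 2 + v ^ 2 + w ^ 2 = 1)
    (horth : a * u + b * v + c * w = 0) :
    s * s' * a ^ 2 + r * s' * b ^ 2 + s * r' * u ^ 2 + r * r' * v ^ 2 ≤ s * s' + r * r' := by
  have hau : a ^ 2 + u ^ 2 ≤ 1 := by
    have hcross : (b * w - c * v) ^ 2 = 1 - a ^ 2 - u ^ 2 := by
      have hbc : b ^ 2 + c ^ 2 = 1 - a ^ 2 := by linarith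
      have hvw : v ^ 2 + w ^ 2 = 1 - u ^ 2 := by linarith
      have hinner : b * v + c * w = -(a * u) := by linarith
      calc (b * w - c * v) ^ 2
          = (b ^ 2 + c ^ 2) * (v ^ 2 + w ^ 2) - (b * v + c * w) ^ 2 := by ring
        _ = 1 - a ^ 2 - u ^ 2 := by rw [hbc, hvw, hinner]; ring
    linarith [sq_nonneg (b * w - c * v)]
  have hab : a ^ 2 + b ^ 2 ≤ 1 := by linarith [sq_nonneg c]
  have huv : u ^ 2 + v ^ 2 ≤ 1 := by linarith [sq_nonneg w]
  have ha : a ^ 2 ≤ 1 := by linarith [sq_nonneg b]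
  have h₁ := mul_nonneg (mul_nonneg_of_nonpos_of_nonpos hr hr')
    (by linarith : 0 ≤ 2 - a ^ 2 - b ^ 2 - u ^ 2 - v ^ 2)
  have h₂ := mul_nonneg (mul_nonneg (sub_nonneg.2 hsr) (neg_nonneg.2 hr')) (sub_nonneg.2 hau)
  have h₃ := mul_nonneg (mul_nonneg (sub_nonneg.2 hsr') (neg_nonneg.2 hr)) (sub_nonneg.2 hab)
  have h₄ := mul_nonneg (mul_nonneg (sub_nonneg.2 hsr) (sub_nonneg.2 hsr')) (sub_nonneg.2 ha)
  linarith
end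

section
/- For every Q ∈ 𝒬_phy and every t ∈ [0,1], the matrix tQ belongs to 𝒬_phy and d(tQ) = √6/6 − t(√6/6 − d(Q)). -/
open Matrix

/-- A real symmetric matrix has a unit eigenvector whose eigenvalue bounds the quadratic form
from below. -/
lemma exists_min_eigenvector {Q : Matrix (Fin 3) (Fin 3) ℝ} (hQ : Q.IsHermitian) :
    ∃ (l : ℝ) (v : Fin 3 → ℝ), l ∈ spectrum ℝ Q ∧ v ⬝ᵥ v = 1 ∧ Q *ᵥ v = l • v ∧
      ∀ w : Fin 3 → ℝ, l * (w ⬝ᵥ w) ≤ w ⬝ᵥ (Q *ᵥ w) := by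
  obtain ⟨i, hi⟩ := Finite.exists_min hQ.eigenvalues
  refine ⟨hQ.eigenvalues i, (hQ.eigenvectorBasis i).ofLp, ?_, ?_,
    hQ.mulVec_eigenvectorBasis i, fun w => ?_⟩
  · rw [hQ.spectrum_real_eq_range_eigenvalues]
    exact ⟨i, rfl⟩
  · have h := hQ.eigenvectorBasis.orthonormal.1 i
    rw [EuclideanSpace.norm_eq, Real.sqrt_eq_one] at h
    simpa [dotProduct, sq] using h
  · have hpsd : (Q - algebraMap ℝ (Matrix (Fin 3) (Fin 3) ℝ) (hQ.eigenvalues i)).PosSemidef := by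
      rw [posSemidef_iff_isHermitian_and_spectrum_nonneg]
      refine ⟨hQ.sub ?_, ?_⟩
      · simp [Matrix.IsHermitian, Algebra.algebraMap_eq_smul_one]
      · intro x hx
        rw [← spectrum.sub_singleton_eq, hQ.spectrum_real_eq_range_eigenvalues] at hx
        obtain ⟨_, ⟨j, rfl⟩, _, rfl, rfl⟩ := hx
        exact sub_nonneg.2 (hi j)
    have h := hpsd.dotProduct_mulVec_nonneg w
    rw [Algebra.algebraMap_eq_smul_one, sub_mulVec, smul_mulVec, one_mulVec, dotProduct_sub,
      dotProduct_smul, smul_eq_mul] at h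
    simpa using h

/-- Among symmetric traceless matrices, the physical ones are those with `Q ≥ -1/3` as a
quadratic form. -/
lemma mem_QPhy_iff {Q : Matrix (Fin 3) (Fin 3) ℝ} (hQ : Q ∈ QSpace) :
    Q ∈ QPhy ↔ ∀ w : Fin 3 → ℝ, -(1:ℝ) / 3 * (w ⬝ᵥ w) ≤ w ⬝ᵥ (Q *ᵥ w) := by
  have hH : Q.IsHermitian := isHermitian_iff_isSymm.2 hQ.1
  constructor
  · intro h w
    obtain ⟨l, v, hl, -, -, hmin⟩ := exists_min_eigenvector hH
    have hw : 0 ≤ w ⬝ᵥ w := by simpa using dotProduct_star_self_nonneg w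
    exact (mul_le_mul_of_nonneg_right (h.2 hl).1 hw).trans (hmin w)
  · intro h
    have hlow : ∀ i, -(1:ℝ) / 3 ≤ hH.eigenvalues i := by
      intro i
      have hn := hH.eigenvectorBasis.orthonormal.1 i
      rw [EuclideanSpace.norm_eq, Real.sqrt_eq_one] at hn
      have hn' : (hH.eigenvectorBasis i).ofLp ⬝ᵥ (hH.eigenvectorBasis i).ofLp = 1 := by
        simpa [dotProduct, sq] using hn
      have := h (hH.eigenvectorBasis i).ofLp
      rwa [hH.mulVec_eigenvectorBasis i, dotProduct_smul, hn', smul_eq_mul, mul_one, mul_one]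
        at this
    have htr := hH.trace_eq_sum_eigenvalues
    rw [hQ.2, Fin.sum_univ_three] at htr
    simp only [RCLike.ofReal_real_eq_id, id_eq] at htr
    refine ⟨hQ, ?_⟩
    rw [hH.spectrum_real_eq_range_eigenvalues]
    rintro _ ⟨i, rfl⟩
    refine ⟨hlow i, ?_⟩
    have h0 := hlow 0
    have h1 := hlow 1
    have h2 := hlow 2
    fin_cases i <;> simp <;> linarith

/-- Cauchy–Schwarz for a traceless matrix against the traceless part of `w wᵀ`. -/
lemma sq_dotProduct_mulVec_le {A : Matrix (Fin 3) (Fin 3) ℝ} (hA : A.trace = 0)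
    (w : Fin 3 → ℝ) :
    (w ⬝ᵥ (A *ᵥ w)) ^ 2 ≤ (∑ i, ∑ j, A i j ^ 2) * (2 / 3 * (w ⬝ᵥ w) ^ 2) := by
  have h := Finset.sum_mul_sq_le_sq_mul_sq Finset.univ (fun p : Fin 3 × Fin 3 => A p.1 p.2)
    (fun p => w p.1 * w p.2 - if p.1 = p.2 then w ⬝ᵥ w / 3 else 0)
  simp only [Fintype.sum_prod_type] at h
  have ht : A 2 2 = -A 0 0 - A 1 1 := by
    rw [trace_fin_three] at hA
    linarith
  have hl : ∑ i, ∑ j, A i j * (w i * w j - if i = j then w ⬝ᵥ w / 3 else 0) =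
      w ⬝ᵥ (A *ᵥ w) := by
    simp [dotProduct, mulVec, Fin.sum_univ_three, ht]
    ring
  have hr : ∑ i, ∑ j, (w i * w j - if i = j then w ⬝ᵥ w / 3 else 0) ^ 2 =
      2 / 3 * (w ⬝ᵥ w) ^ 2 := by
    simp [dotProduct, Fin.sum_univ_three]
    ring
  rwa [hl, hr] at h

lemma frobDist_nonneg (X Y : Matrix (Fin 3) (Fin 3) ℝ) : 0 ≤ frobDist X Y := Real.sqrt_nonneg _

/-- The distance to the non-physical matrices in terms of the smallest eigenvalue. -/
lemma dQ_eq {Q : Matrix (Fin 3) (Fin 3) ℝ} (hQ : Q ∈ QSpace) {l : ℝ} {v : Fin 3 → ℝ}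
    (hv : v ⬝ᵥ v = 1) (hQv : Q *ᵥ v = l • v)
    (hmin : ∀ w : Fin 3 → ℝ, l * (w ⬝ᵥ w) ≤ w ⬝ᵥ (Q *ᵥ w)) (hl : -(1:ℝ) / 3 ≤ l) :
    dQ Q = √6 / 2 * (l + 1 / 3) := by
  have h6 : √6 ^ 2 = 6 := Real.sq_sqrt (by norm_num)
  have hmem : ∀ s, l + 1 / 3 < s → √6 / 2 * s ∈
      (fun Q' => frobDist Q Q') '' (QSpace \ QPhy) := by
    intro s hs
    set B : Matrix (Fin 3) (Fin 3) ℝ := (3 / 2 * s) • (vecMulVec v v - (1 / 3 : ℝ) • 1) with hB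
    have hBs : Bᵀ = B := by simp [hB, transpose_vecMulVec]
    have hBt : B.trace = 0 := by
      simp [hB, trace_vecMulVec, hv]
    have hBv : B *ᵥ v = s • v := by
      rw [hB, smul_mulVec, sub_mulVec, smul_mulVec, one_mulVec, vecMulVec_mulVec, hv]
      ext i
      simp
      ring
    have hS : Q - B ∈ QSpace := by
      refine ⟨?_, ?_⟩
      · rw [Matrix.IsSymm, transpose_sub, hBs, hQ.1.eq]
      · rw [trace_sub, hBt, hQ.2, sub_zero]
    refine ⟨Q - B, ⟨hS, fun hP => ?_⟩, ?_⟩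
    · have h := (mem_QPhy_iff hS).1 hP v
      rw [sub_mulVec, hQv, hBv, dotProduct_sub, dotProduct_smul, dotProduct_smul, hv] at h
      simp only [smul_eq_mul, mul_one] at h
      linarith
    · have hs0 : 0 ≤ s := by linarith
      simp only [frobDist]
      rw [Real.sqrt_eq_iff_mul_self_eq (by positivity) (by positivity)]
      have hv' : v 0 * v 0 + v 1 * v 1 + v 2 * v 2 = 1 := by
        simpa [dotProduct, Fin.sum_univ_three] using hv
      simp [hB, Fin.sum_univ_three, vecMulVec_apply]
      linear_combination -(s ^ 2 / 4) * h6
        + (9 / 4 * s ^ 2) * (v 0 * v 0 + v 1 * v 1 + v 2 * v 2 + 1 / 3) * hv'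
  have hbdd : BddBelow ((fun Q' => frobDist Q Q') '' (QSpace \ QPhy)) :=
    ⟨0, by rintro _ ⟨Q', -, rfl⟩; exact frobDist_nonneg _ _⟩
  apply le_antisymm
  · refine le_of_forall_pos_le_add fun ε hε => ?_
    refine (csInf_le hbdd (hmem (l + 1 / 3 + ε / (√6 / 2)) ?_)).trans_eq ?_
    · have : 0 < ε / (√6 / 2) := by positivity
      linarith
    · field_simp
  · refine le_csInf ⟨_, hmem (l + 1 / 3 + 1) (by linarith)⟩ ?_
    rintro _ ⟨Q', ⟨hS, hP⟩, rfl⟩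
    rw [mem_QPhy_iff hS] at hP
    push Not at hP
    obtain ⟨w, hw⟩ := hP
    have htr : (Q - Q').trace = 0 := by rw [trace_sub, hQ.2, hS.2, sub_zero]
    have hCS := sq_dotProduct_mulVec_le htr w
    have hw0 : 0 ≤ w ⬝ᵥ w := by simpa using dotProduct_star_self_nonneg w
    have hwpos : 0 < w ⬝ᵥ w := by
      refine hw0.lt_of_ne fun h0 => ?_
      have : w = 0 := dotProduct_self_eq_zero.1 h0.symm
      simp [this] at hw
    have hge : (l + 1 / 3) * (w ⬝ᵥ w) ≤ w ⬝ᵥ ((Q - Q') *ᵥ w) := by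
      rw [sub_mulVec, dotProduct_sub]
      linarith [hmin w]
    have hsq := pow_le_pow_left₀ (mul_nonneg (by linarith) hw0) hge 2
    have hfin : (l + 1 / 3) ^ 2 ≤ (∑ i, ∑ j, (Q - Q') i j ^ 2) * (2 / 3) := by
      refine le_of_mul_le_mul_right ?_ (pow_pos hwpos 2)
      linarith
    apply Real.le_sqrt_of_sq_le
    simp only [Matrix.sub_apply] at hfin
    rw [mul_pow, div_pow, h6]
    linarith

/-- For every `Q ∈ 𝒬_phy` and `t ∈ [0,1]`, `tQ ∈ 𝒬_phy` and
`d(tQ) = √6/6 - t(√6/6 - d(Q))`. -/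
theorem stmt14 (Q : Matrix (Fin 3) (Fin 3) ℝ) (hQ : Q ∈ QPhy)
    (t : ℝ) (ht : t ∈ Set.Icc (0:ℝ) 1) :
    t • Q ∈ QPhy ∧ dQ (t • Q) = Real.sqrt 6 / 6 - t * (Real.sqrt 6 / 6 - dQ Q) := by
  obtain ⟨ht0, ht1⟩ := ht
  have hH : Q.IsHermitian := isHermitian_iff_isSymm.2 hQ.1.1
  obtain ⟨l, v, hl, hv, hQv, hmin⟩ := exists_min_eigenvector hH
  have hl3 := (hQ.2 hl).1
  have hS : t • Q ∈ QSpace := ⟨hQ.1.1.smul t, by rw [trace_smul, hQ.1.2, smul_zero]⟩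
  have hmin' : ∀ w : Fin 3 → ℝ, t * l * (w ⬝ᵥ w) ≤ w ⬝ᵥ ((t • Q) *ᵥ w) := by
    intro w
    rw [smul_mulVec, dotProduct_smul, smul_eq_mul, mul_assoc]
    exact mul_le_mul_of_nonneg_left (hmin w) ht0
  have htl : -(1:ℝ) / 3 ≤ t * l := by nlinarith
  refine ⟨(mem_QPhy_iff hS).2 fun w => ?_, ?_⟩
  · have hw0 : 0 ≤ w ⬝ᵥ w := by simpa using dotProduct_star_self_nonneg w
    exact (mul_le_mul_of_nonneg_right htl hw0).trans (hmin' w)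
  · rw [dQ_eq hQ.1 hv hQv hmin hl3,
      dQ_eq hS hv (by rw [smul_mulVec, hQv, smul_smul]) hmin' htl]
    ring
end

section
/- For every Q ∈ 𝒬_phy one has d(Q) ≤ √6/6, with equality if and only if Q = 0. -/
open Matrix

lemma exists_smul_dotProduct_self_eq_one {x : Fin 3 → ℝ} (hx : x ≠ 0) :
    ∃ c : ℝ, 0 < c ∧ (c • x) ⬝ᵥ (c • x) = 1 := by
  have hpos : 0 < x ⬝ᵥ x := by simpa using dotProduct_star_self_pos_iff.2 hx
  refine ⟨(√(x ⬝ᵥ x))⁻¹, by positivity, ?_⟩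
  rw [smul_dotProduct, dotProduct_smul, smul_eq_mul, smul_eq_mul, ← mul_assoc, ← mul_inv,
    Real.mul_self_sqrt hpos.le, inv_mul_cancel₀ hpos.ne']

/-- The quadratic form of a physical Q-tensor is bounded below by `-1/3`. -/
lemma QPhy.neg_third_le_dotProduct {Q : Matrix (Fin 3) (Fin 3) ℝ} (hQ : Q ∈ QPhy)
    {v : Fin 3 → ℝ} (hv : v ⬝ᵥ v = 1) : -(1 : ℝ) / 3 ≤ v ⬝ᵥ Q *ᵥ v := by
  obtain ⟨⟨hs, -⟩, hspec⟩ := hQ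
  have hpsd : (Q + algebraMap ℝ (Matrix (Fin 3) (Fin 3) ℝ) (1 / 3)).PosSemidef := by
    rw [posSemidef_iff_isHermitian_and_spectrum_nonneg]
    constructor
    · rw [Matrix.IsHermitian, conjTranspose_eq_transpose_of_trivial, transpose_add, hs.eq,
        Matrix.algebraMap_eq_diagonal, diagonal_transpose]
    · rw [← spectrum.add_singleton_eq]
      rintro _ ⟨a, ha, _, rfl, rfl⟩
      have := (hspec ha).1
      simp only [Set.mem_ofPred_eq]
      linarith
  have h := hpsd.dotProduct_mulVec_nonneg v
  rw [add_mulVec, dotProduct_add, Algebra.algebraMap_eq_smul_one, smul_mulVec, one_mulVec,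
    dotProduct_smul, star_trivial, hv, smul_eq_mul] at h
  linarith

/-- The traceless uniaxial tensor with director `v` (for `v` a unit vector). -/
noncomputable def uniaxial (v : Fin 3 → ℝ) : Matrix (Fin 3) (Fin 3) ℝ :=
  vecMulVec v v - (1 / 3 : ℝ) • 1

lemma sub_smul_uniaxial_mem_QSpace {Q : Matrix (Fin 3) (Fin 3) ℝ} (hQ : Q ∈ QSpace)
    {v : Fin 3 → ℝ} (hv : v ⬝ᵥ v = 1) (t : ℝ) : Q - t • uniaxial v ∈ QSpace := by
  obtain ⟨hs, ht⟩ := hQ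
  constructor
  · rw [Matrix.IsSymm, transpose_sub, hs.eq, transpose_smul, uniaxial, transpose_sub,
      transpose_vecMulVec, transpose_smul, transpose_one]
  · rw [trace_sub, ht, trace_smul, uniaxial, trace_sub, trace_vecMulVec, hv, trace_smul, trace_one]
    simp

lemma dotProduct_sub_smul_uniaxial_mulVec (Q : Matrix (Fin 3) (Fin 3) ℝ)
    {v : Fin 3 → ℝ} (hv : v ⬝ᵥ v = 1) (t : ℝ) :
    v ⬝ᵥ (Q - t • uniaxial v) *ᵥ v = v ⬝ᵥ Q *ᵥ v - 2 / 3 * t := by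
  simp only [uniaxial, sub_mulVec, smul_mulVec, dotProduct_sub, dotProduct_smul, vecMulVec_mulVec,
    one_mulVec, hv, smul_eq_mul, MulOpposite.op_one, one_smul]
  ring

/-- Squared Frobenius norm of `Q - t • uniaxial v` for traceless `Q`. -/
lemma sum_sq_sub_smul_uniaxial {Q : Matrix (Fin 3) (Fin 3) ℝ} (hQ : Q.trace = 0)
    {v : Fin 3 → ℝ} (hv : v ⬝ᵥ v = 1) (t : ℝ) :
    ∑ i, ∑ j, (Q - t • uniaxial v) i j ^ 2 =
      ∑ i, ∑ j, Q i j ^ 2 - 2 * t * (v ⬝ᵥ Q *ᵥ v) + 2 / 3 * t ^ 2 := by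
  simp only [dotProduct, mulVec, trace, diag_apply, Fin.sum_univ_three] at *
  simp [uniaxial, vecMulVec_apply]
  linear_combination (2 / 3 * t) * hQ +
    t ^ 2 * (v 0 * v 0 + v 1 * v 1 + v 2 * v 2 + 1 / 3) * hv

lemma dQ_le {Q : Matrix (Fin 3) (Fin 3) ℝ} (hQ : Q ∈ QSpace) {v : Fin 3 → ℝ}
    (hv : v ⬝ᵥ v = 1) {t : ℝ} (ht : 0 ≤ t) (h : v ⬝ᵥ Q *ᵥ v - 2 / 3 * t < -1 / 3) :
    dQ Q ≤ √6 / 3 * t := by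
  have hmem : Q - t • uniaxial v ∈ QSpace \ QPhy := by
    refine ⟨sub_smul_uniaxial_mem_QSpace hQ hv t, fun hphy => ?_⟩
    have := QPhy.neg_third_le_dotProduct hphy hv
    rw [dotProduct_sub_smul_uniaxial_mulVec Q hv] at this
    linarith
  have hdist : frobDist Q (Q - t • uniaxial v) = √6 / 3 * t := by
    have hz := sum_sq_sub_smul_uniaxial (Q := 0) (trace_zero _ _) hv t
    have hs : (√6) ^ 2 = 6 := Real.sq_sqrt (by norm_num)
    have hsum : ∑ i, ∑ j, (Q i j - (Q - t • uniaxial v) i j) ^ 2 = (√6 / 3 * t) ^ 2 := by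
      simp only [Matrix.sub_apply, sub_sub_cancel, Matrix.zero_apply, zero_sub, neg_sq, zero_mulVec,
        dotProduct_zero] at hz ⊢
      rw [hz, mul_pow, div_pow, hs, zero_pow two_ne_zero, Finset.sum_const_zero,
        Finset.sum_const_zero]
      ring
    rw [frobDist, hsum, Real.sqrt_sq (by positivity)]
  rw [← hdist]
  refine csInf_le ⟨0, ?_⟩ ⟨_, hmem, rfl⟩
  rintro _ ⟨_, -, rfl⟩
  exact Real.sqrt_nonneg _

/-- A nonzero traceless symmetric matrix has a negative direction. -/
lemma exists_dotProduct_mulVec_neg {Q : Matrix (Fin 3) (Fin 3) ℝ} (hQ : Q ∈ QSpace)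
    (h0 : Q ≠ 0) : ∃ v : Fin 3 → ℝ, v ⬝ᵥ v = 1 ∧ v ⬝ᵥ Q *ᵥ v < 0 := by
  by_contra! hcon
  refine h0 ((PosSemidef.trace_eq_zero_iff (.of_dotProduct_mulVec_nonneg ?_ fun x => ?_)).1 hQ.2)
  · rw [Matrix.IsHermitian, conjTranspose_eq_transpose_of_trivial, hQ.1.eq]
  · rw [star_trivial]
    obtain rfl | hx := eq_or_ne x 0
    · simp
    obtain ⟨c, hc, hx1⟩ := exists_smul_dotProduct_self_eq_one hx
    have := hcon _ hx1
    rw [mulVec_smul, smul_dotProduct, dotProduct_smul, smul_eq_mul, smul_eq_mul, ← mul_assoc] at this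
    exact nonneg_of_mul_nonneg_right this (by positivity)

/-- The squared Frobenius norm of a traceless `3 × 3` matrix is at least `3/2` times the square of
any real eigenvalue. -/
lemma three_halves_mul_sq_le_sum_sq {Q : Matrix (Fin 3) (Fin 3) ℝ} (hQ : Q.trace = 0) {a : ℝ}
    (ha : a ∈ spectrum ℝ Q) : 3 / 2 * a ^ 2 ≤ ∑ i, ∑ j, Q i j ^ 2 := by
  rw [← spectrum_toLin', ← Module.End.hasEigenvalue_iff_mem_spectrum] at ha
  obtain ⟨x, hx⟩ := ha.exists_hasEigenvector
  obtain ⟨c, -, hv⟩ := exists_smul_dotProduct_self_eq_one hx.2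
  have hQv : Q *ᵥ (c • x) = a • (c • x) := by
    rw [mulVec_smul, ← toLin'_apply, hx.apply_eq_smul, smul_comm]
  have h := sum_sq_sub_smul_uniaxial hQ hv (3 / 2 * a)
  rw [hQv, dotProduct_smul, hv, smul_eq_mul] at h
  have : 0 ≤ ∑ i, ∑ j, (Q - (3 / 2 * a) • uniaxial (c • x)) i j ^ 2 := by positivity
  linarith

lemma le_frobDist_zero {Q : Matrix (Fin 3) (Fin 3) ℝ} (hQ : Q ∈ QSpace \ QPhy) :
    √6 / 6 ≤ frobDist 0 Q := by
  obtain ⟨a, ha, hna⟩ := Set.not_subset.1 fun h => hQ.2 ⟨hQ.1, h⟩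
  have h := three_halves_mul_sq_le_sum_sq hQ.1.2 ha
  have ha2 : 1 / 9 ≤ a ^ 2 := by
    by_contra! hlt
    exact hna ⟨by nlinarith, by nlinarith⟩
  apply Real.le_sqrt_of_sq_le
  simp only [Matrix.zero_apply, zero_sub, neg_sq, div_pow]
  rw [Real.sq_sqrt (by norm_num)]
  linarith

/-- For every `Q ∈ 𝒬_phy`, `d(Q) ≤ √6/6`, with equality if and only if `Q = 0`. -/
theorem stmt15 (Q : Matrix (Fin 3) (Fin 3) ℝ) (hQ : Q ∈ QPhy) :
    dQ Q ≤ Real.sqrt 6 / 6 ∧ (dQ Q = Real.sqrt 6 / 6 ↔ Q = 0) := by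
  obtain rfl | h0 := eq_or_ne Q 0
  · have hv : (Pi.single 0 1 : Fin 3 → ℝ) ⬝ᵥ Pi.single 0 1 = 1 := by simp
    have hle : dQ 0 ≤ √6 / 6 := by
      refine le_of_forall_pos_le_add fun ε hε => ?_
      have h6 : 0 < √6 := by positivity
      refine (dQ_le hQ.1 hv (t := 1 / 2 + 3 * ε / √6) (by positivity) ?_).trans_eq ?_
      · have : 0 < 3 * ε / √6 := by positivity
        rw [zero_mulVec, dotProduct_zero]
        linarith
      · field_simp
        ring
    have hge : √6 / 6 ≤ dQ 0 := by
      refine le_csInf (Set.Nonempty.image _ ?_) ?_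
      · refine ⟨_, sub_smul_uniaxial_mem_QSpace hQ.1 hv 1, fun hphy => ?_⟩
        have := QPhy.neg_third_le_dotProduct hphy hv
        rw [dotProduct_sub_smul_uniaxial_mulVec 0 hv, zero_mulVec, dotProduct_zero] at this
        norm_num at this
      · rintro _ ⟨_, h, rfl⟩
        exact le_frobDist_zero h
    exact ⟨hle, iff_of_true (le_antisymm hle hge) rfl⟩
  · obtain ⟨v, hv, hneg⟩ := exists_dotProduct_mulVec_neg hQ.1 h0
    have hlow := QPhy.neg_third_le_dotProduct hQ hv
    have hlt : dQ Q < √6 / 6 := by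
      refine (dQ_le hQ.1 hv (t := 1 / 2 + 3 / 4 * (v ⬝ᵥ Q *ᵥ v)) (by linarith)
        (by linarith)).trans_lt ?_
      have h6 : 0 < √6 := by positivity
      nlinarith [mul_neg_of_pos_of_neg h6 hneg]
    exact ⟨hlt.le, iff_of_false hlt.ne h0⟩
end

section
/- Let k₀ > 0 and m₀ ≤ M₀ be real numbers, and set Λ₀ = exp(1 + (M₀ − m₀)/k₀). Then for every a ∈ (0, 1/(√6·Λ₀)) and every δ ∈ (0, a], with η̂ = (1 − √6·Λ₀·a)/(1 − √6·a), one has 0 < η̂ < 1 and k₀·ln( (η̂·(δ − √6/6) + √6/6)/δ ) − (M₀ − m₀) ≥ k₀. -/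
/-- The rescaled distance exceeds `L * δ` by `(L - 1) * (a - δ) / (1 - s * a)`, when `s ^ 2 = 6`. -/
theorem rescaled_distance_eq {s L a δ : ℝ} (hs : s ^ 2 = 6) (hsa : 1 - s * a ≠ 0) :
    (1 - s * L * a) / (1 - s * a) * (δ - s / 6) + s / 6 =
      L * δ + (L - 1) * (a - δ) / (1 - s * a) := by
  field_simp
  linear_combination (a * (L - 1)) * hs

/-- Scalar inequality for the logarithmic bulk potential: with `k₀ > 0`, `m₀ ≤ M₀`,
`Λ₀ = exp(1 + (M₀ - m₀)/k₀)`, for every `a ∈ (0, 1/(√6 Λ₀))` and `δ ∈ (0, a]`, setting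
`η̂ = (1 - √6 Λ₀ a)/(1 - √6 a)`, one has `0 < η̂ < 1` and
`k₀ ln((η̂(δ - √6/6) + √6/6)/δ) - (M₀ - m₀) ≥ k₀`. -/
theorem stmt17 (k₀ m₀ M₀ : ℝ) (hk : 0 < k₀) (hm : m₀ ≤ M₀)
    (a δ : ℝ)
    (ha : a ∈ Set.Ioo 0 (1 / (Real.sqrt 6 * Real.exp (1 + (M₀ - m₀) / k₀))))
    (hδ : δ ∈ Set.Ioc 0 a) :
    0 < (1 - Real.sqrt 6 * Real.exp (1 + (M₀ - m₀) / k₀) * a) / (1 - Real.sqrt 6 * a) ∧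
    (1 - Real.sqrt 6 * Real.exp (1 + (M₀ - m₀) / k₀) * a) / (1 - Real.sqrt 6 * a) < 1 ∧
    k₀ * Real.log
        (((1 - Real.sqrt 6 * Real.exp (1 + (M₀ - m₀) / k₀) * a) / (1 - Real.sqrt 6 * a) *
            (δ - Real.sqrt 6 / 6) + Real.sqrt 6 / 6) / δ) - (M₀ - m₀) ≥ k₀ := by
  obtain ⟨ha0, ha1⟩ := ha
  obtain ⟨hδ0, hδa⟩ := hδ
  have hs0 : 0 < Real.sqrt 6 := by positivity
  have hs : Real.sqrt 6 ^ 2 = 6 := Real.sq_sqrt (by norm_num)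
  have hquot : 0 ≤ (M₀ - m₀) / k₀ := div_nonneg (sub_nonneg.2 hm) hk.le
  have hlog : k₀ * (1 + (M₀ - m₀) / k₀) = k₀ + (M₀ - m₀) := by field_simp
  have hL1 : 1 < Real.exp (1 + (M₀ - m₀) / k₀) := Real.one_lt_exp_iff.2 (by linarith)
  have hle := Real.log_exp (1 + (M₀ - m₀) / k₀)
  generalize Real.exp (1 + (M₀ - m₀) / k₀) = L at *
  generalize Real.sqrt 6 = s at *
  have hsLa : s * L * a < 1 := by
    rw [lt_div_iff₀ (by positivity)] at ha1
    linarith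
  have hlt : s * a < s * L * a := by
    nlinarith [mul_pos (mul_pos hs0 ha0) (sub_pos.2 hL1)]
  have hsa : 0 < 1 - s * a := by linarith
  refine ⟨div_pos (by linarith) hsa, (div_lt_one hsa).2 (by linarith), ?_⟩
  have hbound : L ≤ ((1 - s * L * a) / (1 - s * a) * (δ - s / 6) + s / 6) / δ := by
    rw [le_div_iff₀ hδ0, rescaled_distance_eq hs hsa.ne']
    exact le_add_of_nonneg_right
      (div_nonneg (mul_nonneg (by linarith) (by linarith)) hsa.le)
  have hmono := mul_le_mul_of_nonneg_left (Real.log_le_log (by linarith) hbound) hk.le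
  rw [hle, hlog] at hmono
  linarith
end
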